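/- Let f be Lipschitz continuous of rank L on an open neighborhood of the closed ball B̄_ε(x), where x ∈ X and ε > 0, let 0 ∉ ∂^ε f(x), let ã be the unique element of minimal norm in ∂^ε f(x), and let h̃ := −ã/‖ã‖. Then every h ∈ X with ‖h − h̃‖ < ‖ã‖/L satisfies f⁰_ε(x;h) < 0, i.e. h is a descent direction of f on B̄_ε(x). -/

import Mathlib

open Filter Metric Set Topology MeasureTheory
open scoped RealInnerProductSpace NNReal

variable {X : Type*} [NormedAddCommGroup X] [InnerProductSpace ℝ X] [CompleteSpace X]

/-- Clarke's generalized directional derivative. -/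
noncomputable def clarkeDeriv (f : X → ℝ) (x h : X) : ℝ :=
  Filter.limsup (fun p : X × ℝ => (f (p.1 + p.2 • h) - f p.1) / p.2)
    ((𝓝 x) ×ˢ (𝓝[>] (0:ℝ)))

/-- Clarke's generalized gradient. -/
noncomputable def clarkeGrad (f : X → ℝ) (x : X) : Set X :=
  {a | ∀ h : X, ⟪a, h⟫ ≤ clarkeDeriv f x h}

/-- The gradient of `f` on the closed ball of radius `ε` about `x`. -/
noncomputable def epsGrad (f : X → ℝ) (ε : ℝ) (x : X) : Set X :=
  closure (convexHull ℝ (⋃ y ∈ Metric.closedBall x ε, clarkeGrad f y))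

/-- The directional derivative of `f` on the closed ball of radius `ε` about `x`. -/
noncomputable def epsDeriv (f : X → ℝ) (ε : ℝ) (x h : X) : ℝ :=
  sSup ((fun y => clarkeDeriv f y h) '' Metric.closedBall x ε)

omit [CompleteSpace X] in
/-- The difference quotients of `f` in direction `h` are eventually bounded by `L * ‖h‖`. -/
theorem eventually_abs_diffQuot_le {f : X → ℝ} {U : Set X} {L : ℝ≥0} {y : X}
    (hU : U ∈ 𝓝 y) (hf : LipschitzOnWith L f U) (h : X) :
    ∀ᶠ p : X × ℝ in (𝓝 y) ×ˢ (𝓝[>] (0 : ℝ)),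
      |(f (p.1 + p.2 • h) - f p.1) / p.2| ≤ L * ‖h‖ := by
  have h1 : Tendsto (fun p : X × ℝ => p.1) ((𝓝 y) ×ˢ (𝓝[>] (0 : ℝ))) (𝓝 y) := tendsto_fst
  have h2 : Tendsto (fun p : X × ℝ => p.1 + p.2 • h) ((𝓝 y) ×ˢ (𝓝[>] (0 : ℝ))) (𝓝 y) := by
    have h3 : Tendsto (fun p : X × ℝ => p.2) ((𝓝 y) ×ˢ (𝓝[>] (0 : ℝ))) (𝓝 0) :=
      tendsto_snd.mono_right nhdsWithin_le_nhds
    simpa using h1.add (h3.smul_const h)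
  have h4 : ∀ᶠ p : X × ℝ in (𝓝 y) ×ˢ (𝓝[>] (0 : ℝ)), 0 < p.2 :=
    tendsto_snd.eventually self_mem_nhdsWithin
  filter_upwards [h1 hU, h2 hU, h4] with p hp1 hp2 hp
  have := hf.dist_le_mul _ hp2 _ hp1
  rw [Real.dist_eq, dist_eq_norm, add_sub_cancel_left, norm_smul, Real.norm_of_nonneg hp.le] at this
  rw [abs_div, abs_of_pos hp, div_le_iff₀ hp]
  linarith

section Lipschitz

variable {f : X → ℝ} {U : Set X} {L : ℝ≥0} {y : X}

omit [CompleteSpace X] in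
theorem clarkeDeriv_le_of_eventually_le (hU : U ∈ 𝓝 y) (hf : LipschitzOnWith L f U) {h : X} {c : ℝ}
    (hc : ∀ᶠ p : X × ℝ in (𝓝 y) ×ˢ (𝓝[>] (0 : ℝ)), (f (p.1 + p.2 • h) - f p.1) / p.2 ≤ c) :
    clarkeDeriv f y h ≤ c := by
  refine limsup_le_of_le ?_ hc
  refine IsBoundedUnder.isCoboundedUnder_le ⟨-(L * ‖h‖), ?_⟩
  rw [eventually_map]
  filter_upwards [eventually_abs_diffQuot_le hU hf h] with p hp using (abs_le.1 hp).1

omit [CompleteSpace X] in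
theorem eventually_lt_of_clarkeDeriv_lt (hU : U ∈ 𝓝 y) (hf : LipschitzOnWith L f U) {h : X} {c : ℝ}
    (hc : clarkeDeriv f y h < c) :
    ∀ᶠ p : X × ℝ in (𝓝 y) ×ˢ (𝓝[>] (0 : ℝ)), (f (p.1 + p.2 • h) - f p.1) / p.2 < c := by
  refine eventually_lt_of_limsup_lt hc ⟨L * ‖h‖, ?_⟩
  rw [eventually_map]
  filter_upwards [eventually_abs_diffQuot_le hU hf h] with p hp using (abs_le.1 hp).2

omit [CompleteSpace X] in
theorem clarkeDeriv_le_mul_norm (hU : U ∈ 𝓝 y) (hf : LipschitzOnWith L f U) (h : X) :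
    clarkeDeriv f y h ≤ L * ‖h‖ :=
  clarkeDeriv_le_of_eventually_le hU hf <|
    (eventually_abs_diffQuot_le hU hf h).mono fun _ hp => (abs_le.1 hp).2

omit [CompleteSpace X] in
theorem clarkeDeriv_add_le (hU : U ∈ 𝓝 y) (hf : LipschitzOnWith L f U) (u v : X) :
    clarkeDeriv f y (u + v) ≤ clarkeDeriv f y u + clarkeDeriv f y v := by
  refine le_of_forall_pos_le_add fun δ hδ => ?_
  have hu := eventually_lt_of_clarkeDeriv_lt hU hf (lt_add_of_pos_right (clarkeDeriv f y u)
    (half_pos hδ))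
  have hv := eventually_lt_of_clarkeDeriv_lt hU hf (lt_add_of_pos_right (clarkeDeriv f y v)
    (half_pos hδ))
  have hshift : Tendsto (fun p : X × ℝ => (p.1 + p.2 • v, p.2)) ((𝓝 y) ×ˢ (𝓝[>] (0 : ℝ)))
      ((𝓝 y) ×ˢ (𝓝[>] (0 : ℝ))) := by
    refine Tendsto.prodMk ?_ tendsto_snd
    have h3 : Tendsto (fun p : X × ℝ => p.2) ((𝓝 y) ×ˢ (𝓝[>] (0 : ℝ))) (𝓝 0) :=
      tendsto_snd.mono_right nhdsWithin_le_nhds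
    simpa using tendsto_fst.add (h3.smul_const v)
  refine clarkeDeriv_le_of_eventually_le hU hf ?_
  filter_upwards [hshift.eventually hu, hv] with p hp1 hp2
  have key : (f (p.1 + p.2 • (u + v)) - f p.1) / p.2 =
      (f (p.1 + p.2 • v + p.2 • u) - f (p.1 + p.2 • v)) / p.2 +
        (f (p.1 + p.2 • v) - f p.1) / p.2 := by
    rw [smul_add, add_comm (p.2 • u), ← add_assoc]
    ring
  rw [key]
  linarith

omit [CompleteSpace X] in
theorem clarkeDeriv_smul_le (hU : U ∈ 𝓝 y) (hf : LipschitzOnWith L f U) {c : ℝ} (hc : 0 < c)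
    (u : X) : clarkeDeriv f y (c • u) ≤ c * clarkeDeriv f y u := by
  rw [← div_le_iff₀' hc]
  refine le_of_forall_pos_le_add fun δ hδ => ?_
  rw [div_le_iff₀' hc]
  have hu := eventually_lt_of_clarkeDeriv_lt hU hf (lt_add_of_pos_right (clarkeDeriv f y u) hδ)
  have hscale : Tendsto (fun p : X × ℝ => (p.1, p.2 * c)) ((𝓝 y) ×ˢ (𝓝[>] (0 : ℝ)))
      ((𝓝 y) ×ˢ (𝓝[>] (0 : ℝ))) := by
    refine Tendsto.prodMk tendsto_fst (tendsto_nhdsWithin_iff.2 ⟨?_, ?_⟩)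
    · have h3 : Tendsto (fun p : X × ℝ => p.2) ((𝓝 y) ×ˢ (𝓝[>] (0 : ℝ))) (𝓝 0) :=
        tendsto_snd.mono_right nhdsWithin_le_nhds
      simpa using h3.mul_const c
    · have h4 : ∀ᶠ p : X × ℝ in (𝓝 y) ×ˢ (𝓝[>] (0 : ℝ)), 0 < p.2 :=
        tendsto_snd.eventually self_mem_nhdsWithin
      exact h4.mono fun p hp => mul_pos hp hc
  refine clarkeDeriv_le_of_eventually_le hU hf ?_
  filter_upwards [hscale.eventually hu] with p hp
  have key : (f (p.1 + p.2 • c • u) - f p.1) / p.2 =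
      c * ((f (p.1 + (p.2 * c) • u) - f p.1) / (p.2 * c)) := by
    rw [smul_smul, ← mul_div_assoc, mul_comm p.2 c, mul_div_mul_left _ _ hc.ne']
  rw [key]
  exact mul_le_mul_of_nonneg_left hp.le hc.le

omit [CompleteSpace X] in
theorem clarkeDeriv_smul (hU : U ∈ 𝓝 y) (hf : LipschitzOnWith L f U) {c : ℝ} (hc : 0 < c)
    (u : X) : clarkeDeriv f y (c • u) = c * clarkeDeriv f y u := by
  refine le_antisymm (clarkeDeriv_smul_le hU hf hc u) ?_
  have := clarkeDeriv_smul_le hU hf (inv_pos.2 hc) (c • u)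
  rwa [inv_smul_smul₀ hc.ne', le_inv_mul_iff₀ hc] at this

omit [CompleteSpace X] in
theorem clarkeDeriv_zero (f : X → ℝ) (y : X) : clarkeDeriv f y 0 = 0 := by
  simp [clarkeDeriv]

/-- The supremum of `⟪b, h⟫` over the Clarke gradient is attained and equals `clarkeDeriv f y h`. -/
theorem exists_mem_clarkeGrad_inner_eq (hU : U ∈ 𝓝 y) (hf : LipschitzOnWith L f U) (h : X) :
    ∃ b ∈ clarkeGrad f y, ⟪b, h⟫ = clarkeDeriv f y h := by
  have hz : ∀ c : ℝ, c • h = 0 → c • clarkeDeriv f y h = 0 := by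
    intro c hc
    rcases smul_eq_zero.1 hc with rfl | rfl
    · simp
    · simp [clarkeDeriv_zero]
  obtain ⟨g, hg, hgN⟩ := exists_extension_of_le_sublinear
    (LinearPMap.mkSpanSingleton' h (clarkeDeriv f y h) hz) (clarkeDeriv f y)
    (fun c hc u => clarkeDeriv_smul hU hf hc u) (clarkeDeriv_add_le hU hf) (by
      rintro ⟨w, hw⟩
      obtain ⟨c, rfl⟩ := Submodule.mem_span_singleton.1 hw
      rw [LinearPMap.mkSpanSingleton'_apply, smul_eq_mul]
      rcases lt_trichotomy c 0 with hc | rfl | hc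
      · have h1 := clarkeDeriv_add_le hU hf (c • h) ((-c) • h)
        rw [clarkeDeriv_smul hU hf (neg_pos.2 hc), ← add_smul, add_neg_cancel, zero_smul,
          clarkeDeriv_zero] at h1
        change c * clarkeDeriv f y h ≤ clarkeDeriv f y (c • h)
        linarith
      · simp [clarkeDeriv_zero]
      · exact (clarkeDeriv_smul hU hf hc h).ge)
  have hgb : ∀ u, ‖g u‖ ≤ L * ‖u‖ := by
    intro u
    rw [Real.norm_eq_abs, abs_le']
    refine ⟨(hgN u).trans (clarkeDeriv_le_mul_norm hU hf u), ?_⟩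
    have := (hgN (-u)).trans (clarkeDeriv_le_mul_norm hU hf (-u))
    rwa [map_neg, norm_neg] at this
  refine ⟨(InnerProductSpace.toDual ℝ X).symm (g.mkContinuous L hgb), fun u => ?_, ?_⟩
  · simpa using hgN u
  · have h1 := hg ⟨h, Submodule.mem_span_singleton_self h⟩
    have h2 := LinearPMap.mkSpanSingleton'_apply_self (σ := RingHom.id ℝ) h (clarkeDeriv f y h) hz
      (Submodule.mem_span_singleton_self h)
    simpa using h1.trans h2

omit [CompleteSpace X] in
theorem norm_le_of_mem_clarkeGrad (hU : U ∈ 𝓝 y) (hf : LipschitzOnWith L f U) {b : X}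
    (hb : b ∈ clarkeGrad f y) : ‖b‖ ≤ L := by
  rcases (norm_nonneg b).eq_or_lt with h0 | h0
  · simp [← h0]
  · have := (hb b).trans (clarkeDeriv_le_mul_norm hU hf b)
    rw [real_inner_self_eq_norm_mul_norm] at this
    exact le_of_mul_le_mul_right this h0

end Lipschitz

omit [CompleteSpace X] in
theorem convex_epsGrad (f : X → ℝ) (ε : ℝ) (x : X) : Convex ℝ (epsGrad f ε x) :=
  (convex_convexHull ℝ _).closure

omit [CompleteSpace X] in
theorem clarkeGrad_subset_epsGrad (f : X → ℝ) {ε : ℝ} {x y : X} (hy : y ∈ closedBall x ε) :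
    clarkeGrad f y ⊆ epsGrad f ε x :=
  (subset_biUnion_of_mem (u := fun y => clarkeGrad f y) hy).trans
    ((subset_convexHull ℝ _).trans subset_closure)

/-- An element of minimal norm `a` of a convex set satisfies `‖a‖ ^ 2 ≤ ⟪b, a⟫` on the set. -/
theorem Convex.sq_norm_le_inner_of_forall_norm_le {E : Type*} [NormedAddCommGroup E]
    [InnerProductSpace ℝ E] {s : Set E} (hs : Convex ℝ s) {a b : E} (ha : a ∈ s)
    (hmin : ∀ c ∈ s, ‖a‖ ≤ ‖c‖) (hb : b ∈ s) : ‖a‖ ^ 2 ≤ ⟪b, a⟫ := by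
  have hinf : ‖(0 : E) - a‖ = ⨅ w : s, ‖(0 : E) - w‖ := by
    have : Nonempty s := ⟨⟨a, ha⟩⟩
    refine le_antisymm (le_ciInf fun w => by simpa using hmin w w.2) ?_
    exact ciInf_le ⟨0, by rintro _ ⟨w, rfl⟩; exact norm_nonneg _⟩ (⟨a, ha⟩ : s)
  have := (norm_eq_iInf_iff_real_inner_le_zero hs ha).1 hinf b hb
  rw [zero_sub, inner_neg_left, inner_sub_right, real_inner_self_eq_norm_sq,
    real_inner_comm] at this
  linarith

/-- Corollary 2.4: every `h` with `‖h - h̃‖ < ‖ã‖/L` is a descent direction on the ball. -/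
theorem descent_direction_of_close_to_optimal
    (f : X → ℝ) (x : X) (ε : ℝ) (hε : 0 < ε) (L : ℝ≥0) (U : Set X)
    (hU : IsOpen U) (hBU : Metric.closedBall x ε ⊆ U)
    (hf : LipschitzOnWith L f U)
    (hreg : (0 : X) ∉ epsGrad f ε x)
    (a : X) (ha : a ∈ epsGrad f ε x) (hamin : ∀ b ∈ epsGrad f ε x, ‖a‖ ≤ ‖b‖) :
    ∀ h : X, ‖h - (-(‖a‖⁻¹ • a))‖ < ‖a‖ / (L : ℝ) → epsDeriv f ε x h < 0 := by
  intro h hh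
  have hL : 0 < (L : ℝ) := by
    refine lt_of_le_of_ne L.2 fun h0 => ?_
    rw [← h0, div_zero] at hh
    exact (norm_nonneg _).not_gt hh
  have ha0 : 0 < ‖a‖ := norm_pos_iff.2 fun h0 => hreg (h0 ▸ ha)
  rw [lt_div_iff₀ hL] at hh
  refine lt_of_le_of_lt (b := -‖a‖ + ‖h - (-(‖a‖⁻¹ • a))‖ * L) ?_ (by linarith)
  refine csSup_le ((nonempty_closedBall.2 hε.le).image _) ?_
  rintro _ ⟨y, hy, rfl⟩
  have hUy : U ∈ 𝓝 y := hU.mem_nhds (hBU hy)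
  obtain ⟨b, hb, hbh⟩ := exists_mem_clarkeGrad_inner_eq hUy hf h
  have hba := (convex_epsGrad f ε x).sq_norm_le_inner_of_forall_norm_le ha hamin
    (clarkeGrad_subset_epsGrad f hy hb)
  have hsplit : ⟪b, h⟫ = -(‖a‖⁻¹ * ⟪b, a⟫) + ⟪b, h - (-(‖a‖⁻¹ • a))⟫ := by
    rw [inner_sub_right, inner_neg_right, real_inner_smul_right]
    ring
  have h1 : ‖a‖ ≤ ‖a‖⁻¹ * ⟪b, a⟫ := by
    rw [le_inv_mul_iff₀ ha0]
    linarith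
  have h2 : ⟪b, h - (-(‖a‖⁻¹ • a))⟫ ≤ ‖h - (-(‖a‖⁻¹ • a))‖ * L := by
    refine (real_inner_le_norm _ _).trans ?_
    rw [mul_comm]
    exact mul_le_mul_of_nonneg_left (norm_le_of_mem_clarkeGrad hUy hf hb) (norm_nonneg _)
  change clarkeDeriv f y h ≤ _
  linarith
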